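/- arXiv:2101.03739 — 3 statements merged into one kernel-verified Lean document; each statement's English description precedes it below -/
import Mathlib

section
/- If the weak Pareto efficient solution set SOL^w(K_∞, f^∞) is nonempty, then it is a cone: 0 ∈ SOL^w(K_∞, f^∞) and for every v ∈ SOL^w(K_∞, f^∞) and every t > 0, one has tv ∈ SOL^w(K_∞, f^∞). -/
open Filter Topology MvPolynomial

/-- The asymptotic cone of a set `K ⊆ ℝⁿ`:
`K_∞ = {v : ∃ t_k → +∞, x_k ∈ K with x_k / t_k → v}`. -/
def asympCone {n : ℕ} (K : Set (Fin n → ℝ)) : Set (Fin n → ℝ) :=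
  {v | ∃ (t : ℕ → ℝ) (x : ℕ → (Fin n → ℝ)), (∀ k, x k ∈ K) ∧
    Tendsto t atTop atTop ∧ Tendsto (fun k => (t k)⁻¹ • x k) atTop (nhds v)}

/-- The weak Pareto efficient solution set of the vector function `p` on `C`:
`x* ∈ C` such that for no `x ∈ C` we have `p(x) - p(x*) ∈ -int ℝˢ₊`. -/
def SOLw {n s : ℕ} (C : Set (Fin n → ℝ)) (p : Fin s → (Fin n → ℝ) → ℝ) : Set (Fin n → ℝ) :=
  {x | x ∈ C ∧ ∀ y ∈ C, ¬ (∀ i, p i y < p i x)}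

/-- The Pareto efficient solution set of the vector function `p` on `C`:
`x* ∈ C` such that for no `x ∈ C` we have `p(x) - p(x*) ∈ -ℝˢ₊ \ {0}`. -/
def SOLs {n s : ℕ} (C : Set (Fin n → ℝ)) (p : Fin s → (Fin n → ℝ) → ℝ) : Set (Fin n → ℝ) :=
  {x | x ∈ C ∧ ∀ y ∈ C, ¬ ((∀ i, p i y ≤ p i x) ∧ (∃ i, p i y < p i x))}

/-- The set of global minimizers of the scalar function `q` on `C`. -/
def SOLmin {n : ℕ} (C : Set (Fin n → ℝ)) (q : (Fin n → ℝ) → ℝ) : Set (Fin n → ℝ) :=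
  {x | x ∈ C ∧ ∀ y ∈ C, q x ≤ q y}

/-- The recession polynomial (vector leading term) of `p`, as a function:
`p^∞(x) = lim_{λ→+∞} p(λx)/λ^{deg p}`, i.e. the evaluation of the homogeneous
component of `p` of top degree. -/
noncomputable def recFn {n : ℕ} (p : MvPolynomial (Fin n) ℝ) : (Fin n → ℝ) → ℝ :=
  fun x => eval x (homogeneousComponent p.totalDegree p)

/-- Evaluation of a polynomial, as a function `ℝⁿ → ℝ`. -/
noncomputable def evalFn {n : ℕ} (p : MvPolynomial (Fin n) ℝ) : (Fin n → ℝ) → ℝ :=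
  fun x => eval x p

/-- `⟨∇p^∞(x), y⟩`: the inner product of the gradient of the recession polynomial
of `p` at `x` with `y`. -/
noncomputable def gradRecInner {n : ℕ} (p : MvPolynomial (Fin n) ℝ) (x y : Fin n → ℝ) : ℝ :=
  ∑ j, (eval x (pderiv j (homogeneousComponent p.totalDegree p))) * y j

/-- `x` is a solution of the weak vector complementarity problem
`WVCP(C, ∇f^∞)`. -/
def isWVCPsol {n s : ℕ} (C : Set (Fin n → ℝ)) (f : Fin s → MvPolynomial (Fin n) ℝ)
    (x : Fin n → ℝ) : Prop :=
  x ∈ C ∧ (∀ y ∈ C, ¬ (∀ i, gradRecInner (f i) x y < 0)) ∧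
    ¬ (∀ i, 0 < gradRecInner (f i) x x)

theorem recFn_smul {n : ℕ} (p : MvPolynomial (Fin n) ℝ) (t : ℝ) (x : Fin n → ℝ) :
    recFn p (t • x) = t ^ p.totalDegree * recFn p x := by
  have hh := homogeneousComponent_isHomogeneous p.totalDegree p
  unfold recFn
  generalize homogeneousComponent p.totalDegree p = q at hh
  rw [eval_eq, eval_eq, Finset.mul_sum]
  refine Finset.sum_congr rfl fun m hm => ?_
  have hd : ∑ i ∈ m.support, m i = p.totalDegree := by
    have := hh (mem_support_iff.mp hm)
    rw [Finsupp.weight_apply] at this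
    simpa [Finsupp.sum] using this
  simp only [Pi.smul_apply, smul_eq_mul, mul_pow, Finset.prod_mul_distrib,
    Finset.prod_pow_eq_pow_sum, hd]
  ring

theorem asympCone_smul {n : ℕ} {K : Set (Fin n → ℝ)} {v : Fin n → ℝ} (hv : v ∈ asympCone K)
    {c : ℝ} (hc : 0 < c) : c • v ∈ asympCone K := by
  obtain ⟨t, x, hx, ht, hl⟩ := hv
  refine ⟨fun k => c⁻¹ * t k, x, hx, ht.const_mul_atTop (inv_pos.mpr hc), ?_⟩
  have := hl.const_smul c
  refine this.congr fun k => ?_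
  rw [smul_smul, mul_inv, inv_inv]

theorem zero_mem_asympCone {n : ℕ} {K : Set (Fin n → ℝ)} (hK : K.Nonempty) :
    (0 : Fin n → ℝ) ∈ asympCone K := by
  obtain ⟨x, hx⟩ := hK
  refine ⟨fun k => (k : ℝ), fun _ => x, fun _ => hx, tendsto_natCast_atTop_atTop, ?_⟩
  have h : Tendsto (fun k : ℕ => ((k : ℝ))⁻¹) atTop (nhds 0) :=
    tendsto_inv_atTop_zero.comp tendsto_natCast_atTop_atTop
  simpa using h.smul_const x

theorem stmt1 {n s : ℕ} (hs : 0 < s) (K : Set (Fin n → ℝ)) (hK : K.Nonempty) (hKc : IsClosed K)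
    (f : Fin s → MvPolynomial (Fin n) ℝ) (hdeg : ∀ i, 1 ≤ (f i).totalDegree)
    (hne : (SOLw (asympCone K) (fun i => recFn (f i))).Nonempty) :
    (0 : Fin n → ℝ) ∈ SOLw (asympCone K) (fun i => recFn (f i)) ∧
      ∀ v ∈ SOLw (asympCone K) (fun i => recFn (f i)), ∀ t : ℝ, 0 < t →
        t • v ∈ SOLw (asympCone K) (fun i => recFn (f i)) := by
  constructor
  · refine ⟨zero_mem_asympCone hK, fun y hy hlt => ?_⟩
    obtain ⟨x0, -, hx0⟩ := hne
    have hneg : ∀ i, recFn (f i) y < 0 := by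
      intro i
      have h0 := recFn_smul (f i) 0 (0 : Fin n → ℝ)
      rw [zero_smul, zero_pow (by have := hdeg i; omega), zero_mul] at h0
      have := hlt i
      simp only [h0] at this
      exact this
    have hev : ∀ᶠ c : ℝ in atTop, ∀ i, recFn (f i) (c • y) < recFn (f i) x0 := by
      rw [eventually_all]
      intro i
      have ht : Tendsto (fun c : ℝ => c ^ (f i).totalDegree * recFn (f i) y) atTop atBot :=
        (tendsto_pow_atTop (by have := hdeg i; omega)).atTop_mul_const_of_neg (hneg i)
      filter_upwards [ht.eventually_lt_atBot (recFn (f i) x0)] with c hc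
      rwa [recFn_smul]
    obtain ⟨c, hc, hc0⟩ := (hev.and (eventually_gt_atTop 0)).exists
    exact hx0 _ (asympCone_smul hy hc0) hc
  · rintro v ⟨hv, hmin⟩ t ht
    refine ⟨asympCone_smul hv ht, fun y hy hlt => ?_⟩
    refine hmin _ (asympCone_smul hy (inv_pos.mpr ht)) fun i => ?_
    have := hlt i
    simp only [recFn_smul] at this ⊢
    rw [inv_pow, inv_mul_lt_iff₀ (pow_pos ht _)]
    exact this
end

section
/- If SOL^s(K_∞, f^∞) = {0}, then the Pareto efficient solution set SOL^s(K, f) is nonempty. -/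
open Filter Topology MvPolynomial

lemma hom_eval_smul {n d : ℕ} {p : MvPolynomial (Fin n) ℝ} (hp : p.IsHomogeneous d) (t : ℝ)
    (u : Fin n → ℝ) : eval (t • u) p = t ^ d * eval u p := by
  rw [eval_eq', eval_eq', Finset.mul_sum]
  refine Finset.sum_congr rfl fun m hm => ?_
  have hm' : ∑ i, m i = d := by
    have := hp (mem_support_iff.1 hm)
    rw [← this, Finsupp.weight_apply, Finsupp.sum_fintype] <;> simp
  simp only [Pi.smul_apply, smul_eq_mul, mul_pow, Finset.prod_mul_distrib,
    Finset.prod_pow_eq_pow_sum, hm']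
  ring

lemma tendsto_rec {n : ℕ} (p : MvPolynomial (Fin n) ℝ) (t : ℕ → ℝ) (x : ℕ → Fin n → ℝ)
    (v : Fin n → ℝ) (ht : Tendsto t atTop atTop)
    (hx : Tendsto (fun k => (t k)⁻¹ • x k) atTop (nhds v)) :
    Tendsto (fun k => ((t k) ^ p.totalDegree)⁻¹ * eval (x k) p) atTop (nhds (recFn p v)) := by
  have key : ∀ j ∈ Finset.range (p.totalDegree + 1),
      Tendsto (fun k => ((t k) ^ p.totalDegree)⁻¹ * eval (x k) (homogeneousComponent j p)) atTop
        (nhds (if j = p.totalDegree then recFn p v else 0)) := by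
    intro j hj
    have hc : Tendsto (fun k => eval ((t k)⁻¹ • x k) (homogeneousComponent j p)) atTop
        (nhds (eval v (homogeneousComponent j p))) :=
      ((MvPolynomial.continuous_eval _).tendsto v).comp hx
    have hc2 : Tendsto (fun k => ((t k) ^ (p.totalDegree - j))⁻¹) atTop
        (nhds (if j = p.totalDegree then 1 else 0)) := by
      split_ifs with hjd
      · subst hjd; simp
      · refine tendsto_inv_atTop_zero.comp ((tendsto_pow_atTop ?_).comp ht)
        have := Finset.mem_range.1 hj
        omega
    have h3 := hc2.mul hc
    have e : (if j = p.totalDegree then (1:ℝ) else 0) * eval v (homogeneousComponent j p)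
        = if j = p.totalDegree then recFn p v else 0 := by
      split_ifs with hjd
      · subst hjd; simp [recFn]
      · simp
    rw [e] at h3
    refine h3.congr' ?_
    filter_upwards [ht.eventually_gt_atTop 0] with k hk
    rw [hom_eval_smul (homogeneousComponent_isHomogeneous j p), ← mul_assoc]
    congr 1
    have : p.totalDegree = (p.totalDegree - j) + j := by
      have := Finset.mem_range.1 hj
      omega
    conv_rhs => rw [this, pow_add]
    rw [inv_pow, mul_inv]
  have hs := tendsto_finsetSum _ key
  simp only [← Finset.mul_sum, ← map_sum, sum_homogeneousComponent] at hs
  simpa using hs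

theorem stmt9 {n s : ℕ} (hs : 0 < s) (K : Set (Fin n → ℝ)) (hK : K.Nonempty) (hKc : IsClosed K)
    (f : Fin s → MvPolynomial (Fin n) ℝ) (hdeg : ∀ i, 1 ≤ (f i).totalDegree)
    (h : SOLs (asympCone K) (fun i => recFn (f i)) = {0}) :
    (SOLs K (fun i => evalFn (f i))).Nonempty := by
  have h0 : (0 : Fin n → ℝ) ∈ SOLs (asympCone K) (fun i => recFn (f i)) := by rw [h]; rfl
  have hr0 : ∀ i, recFn (f i) 0 = 0 := by
    intro i
    have := hom_eval_smul (homogeneousComponent_isHomogeneous (f i).totalDegree (f i)) 0 0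
    have hd := hdeg i
    rw [zero_pow (by omega), zero_mul, smul_zero] at this
    exact this
  have hpos : ∀ v ∈ asympCone K, (∀ i, recFn (f i) v ≤ 0) → v = 0 := by
    intro v hv hle
    have heq : ∀ i, recFn (f i) v = 0 := by
      intro i
      by_contra hne
      exact h0.2 v hv ⟨fun j => by simpa [hr0] using hle j, i, by
        simpa [hr0] using lt_of_le_of_ne (hle i) hne⟩
    have : v ∈ SOLs (asympCone K) (fun i => recFn (f i)) := by
      refine ⟨hv, fun y hy => ?_⟩
      have := h0.2 y hy
      simpa only [heq, hr0] using this
    rw [h] at this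
    exact this
  obtain ⟨x0, hx0⟩ := hK
  set L : Set (Fin n → ℝ) := K ∩ ⋂ i, {x | eval x (f i) ≤ eval x0 (f i)} with hL
  have hLc : IsClosed L := hKc.inter (isClosed_iInter fun i =>
    isClosed_le (MvPolynomial.continuous_eval _) continuous_const)
  have hx0L : x0 ∈ L := ⟨hx0, by simp⟩
  have hLb : Bornology.IsBounded L := by
    by_contra hnb
    have hex : ∀ k : ℕ, ∃ x ∈ L, (k : ℝ) < ‖x‖ := by
      intro k
      by_contra! hcon
      exact hnb (isBounded_iff_forall_norm_le.2 ⟨k, hcon⟩)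
    choose x hxL hxk using hex
    have ht : Tendsto (fun k => ‖x k‖) atTop atTop :=
      tendsto_atTop_mono (fun k => (hxk k).le) tendsto_natCast_atTop_atTop
    have hsph : ∀ k, (‖x k‖)⁻¹ • x k ∈ Metric.sphere (0 : Fin n → ℝ) 1 := by
      intro k
      have : 0 < ‖x k‖ := lt_of_le_of_lt (Nat.cast_nonneg k) (hxk k)
      rw [mem_sphere_zero_iff_norm, norm_smul, norm_inv, norm_norm, inv_mul_cancel₀ this.ne']
    obtain ⟨v, hv, φ, hφ, hlim⟩ := (isCompact_sphere (0 : Fin n → ℝ) 1).tendsto_subseq hsph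
    have htφ := ht.comp hφ.tendsto_atTop
    have hvK : v ∈ asympCone K :=
      ⟨fun k => ‖x (φ k)‖, fun k => x (φ k), fun k => (hxL _).1, htφ, hlim⟩
    have hv0 : v = 0 := by
      refine hpos v hvK fun i => ?_
      have h1 := tendsto_rec (f i) (fun k => ‖x (φ k)‖) (fun k => x (φ k)) v htφ hlim
      have hd := hdeg i
      have h2 : Tendsto (fun k => (‖x (φ k)‖ ^ (f i).totalDegree)⁻¹ * eval x0 (f i)) atTop
          (nhds (0 * eval x0 (f i))) :=
        (tendsto_inv_atTop_zero.comp ((tendsto_pow_atTop (by omega)).comp htφ)).mul_const _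
      rw [zero_mul] at h2
      refine le_of_tendsto_of_tendsto' h1 h2 fun k => ?_
      have := Set.mem_iInter.1 (hxL (φ k)).2 i
      exact mul_le_mul_of_nonneg_left this (by positivity)
    rw [hv0] at hv
    simp at hv
  have hLcomp : IsCompact L := Metric.isCompact_of_isClosed_isBounded hLc hLb
  obtain ⟨z, hz, hmin⟩ := hLcomp.exists_isMinOn ⟨x0, hx0L⟩
    (f := fun x => ∑ i, eval x (f i))
    (continuous_finsetSum _ fun i _ => MvPolynomial.continuous_eval (f i)).continuousOn
  refine ⟨z, hz.1, ?_⟩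
  rintro y hy ⟨hle, i, hi⟩
  have hyL : y ∈ L := ⟨hy, Set.mem_iInter.2 fun j =>
    (hle j).trans (Set.mem_iInter.1 hz.2 j)⟩
  have h1 : ∑ i, eval z (f i) ≤ ∑ i, eval y (f i) := hmin hyL
  have h2 : ∑ i, eval y (f i) < ∑ i, eval z (f i) :=
    Finset.sum_lt_sum (fun j _ => hle j) ⟨i, Finset.mem_univ i, hi⟩
  linarith
end

section
/- If 0 ∉ SOL^w(K_∞, f^∞), then SOL^w(K, f) = ∅. -/
open Filter Topology MvPolynomial

theorem eval_smul_homog {n d : ℕ} {p : MvPolynomial (Fin n) ℝ} (hp : p.IsHomogeneous d)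
    (c : ℝ) (x : Fin n → ℝ) : eval (c • x) p = c ^ d * eval x p := by
  rw [eval_eq, eval_eq, Finset.mul_sum]
  refine Finset.sum_congr rfl fun m hm => ?_
  have h1 : ∑ i ∈ m.support, m i = d := by
    have := hp (mem_support_iff.mp hm)
    rw [← this, Finsupp.weight_apply, Finsupp.sum]
    simp
  simp only [Pi.smul_apply, smul_eq_mul, mul_pow, Finset.prod_mul_distrib]
  rw [Finset.prod_pow_eq_pow_sum, h1]
  ring

theorem tendsto_eval_div {n : ℕ} (p : MvPolynomial (Fin n) ℝ) (t : ℕ → ℝ)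
    (x : ℕ → (Fin n → ℝ)) (v : Fin n → ℝ) (ht : Tendsto t atTop atTop)
    (hx : Tendsto (fun k => (t k)⁻¹ • x k) atTop (nhds v)) :
    Tendsto (fun k => eval (x k) p / (t k) ^ p.totalDegree) atTop (nhds (recFn p v)) := by
  have key : Tendsto (fun k => ∑ j ∈ Finset.range (p.totalDegree + 1),
      (t k ^ j / t k ^ p.totalDegree) * eval ((t k)⁻¹ • x k) (homogeneousComponent j p)) atTop
      (nhds (∑ j ∈ Finset.range (p.totalDegree + 1),
        (if j = p.totalDegree then (1 : ℝ) else 0) * eval v (homogeneousComponent j p))) := by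
    refine tendsto_finset_sum _ fun j hj => ?_
    refine Tendsto.mul ?_ (((MvPolynomial.continuous_eval _).tendsto v).comp hx)
    split_ifs with hjd
    · subst hjd
      refine tendsto_const_nhds.congr' ?_
      filter_upwards [ht.eventually_gt_atTop 0] with k hk
      rw [div_self (pow_pos hk _).ne']
    · have hlt : j < p.totalDegree := by
        have := Finset.mem_range.mp hj
        omega
      exact (tendsto_pow_div_pow_atTop_zero hlt).comp ht
  have h2 : (∑ j ∈ Finset.range (p.totalDegree + 1),
        (if j = p.totalDegree then (1 : ℝ) else 0) * eval v (homogeneousComponent j p))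
        = recFn p v := by
    simp [recFn]
  rw [h2] at key
  refine key.congr' ?_
  filter_upwards [ht.eventually_gt_atTop 0] with k hk
  have h3 : x k = t k • ((t k)⁻¹ • x k) := by
    rw [smul_smul, mul_inv_cancel₀ hk.ne', one_smul]
  have h4 : eval (x k) p = ∑ j ∈ Finset.range (p.totalDegree + 1),
      t k ^ j * eval ((t k)⁻¹ • x k) (homogeneousComponent j p) := by
    conv_lhs => rw [← sum_homogeneousComponent p, map_sum]
    refine Finset.sum_congr rfl fun j _ => ?_
    rw [← eval_smul_homog (homogeneousComponent_isHomogeneous j p), ← h3]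
  rw [h4, Finset.sum_div]
  refine Finset.sum_congr rfl fun j _ => ?_
  ring

theorem stmt13 {n s : ℕ} (hs : 0 < s) (K : Set (Fin n → ℝ)) (hK : K.Nonempty) (hKc : IsClosed K)
    (f : Fin s → MvPolynomial (Fin n) ℝ) (hdeg : ∀ i, 1 ≤ (f i).totalDegree)
    (h : (0 : Fin n → ℝ) ∉ SOLw (asympCone K) (fun i => recFn (f i))) :
    SOLw K (fun i => evalFn (f i)) = ∅ := by
  obtain ⟨x₀, hx₀⟩ := hK
  have h0 : (0 : Fin n → ℝ) ∈ asympCone K := by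
    refine ⟨fun k => (k : ℝ), fun _ => x₀, fun _ => hx₀, tendsto_natCast_atTop_atTop, ?_⟩
    have := (tendsto_inv_atTop_zero.comp
      (tendsto_natCast_atTop_atTop (R := ℝ))).smul_const x₀
    simpa using this
  have h1 : ∃ v ∈ asympCone K, ∀ i, recFn (f i) v < recFn (f i) 0 := by
    by_contra hcon
    exact h ⟨h0, fun y hy hlt => hcon ⟨y, hy, hlt⟩⟩
  obtain ⟨v, ⟨t, x, hxK, ht, hx⟩, hv⟩ := h1
  refine Set.eq_empty_iff_forall_notMem.mpr fun z hz => ?_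
  have hev : ∀ᶠ k in atTop, ∀ i, eval (x k) (f i) < eval z (f i) := by
    rw [eventually_all]
    intro i
    have hd : (f i).totalDegree ≠ 0 := by have := hdeg i; omega
    have hneg : recFn (f i) v < 0 := by
      have hz0 : recFn (f i) 0 = 0 := by
        have := eval_smul_homog (homogeneousComponent_isHomogeneous (f i).totalDegree (f i)) 0 0
        simpa [recFn, hd] using this
      rw [← hz0]
      exact hv i
    have hp := (tendsto_pow_atTop hd).comp ht
    have hm := (tendsto_eval_div (f i) t x v ht hx).neg_mul_atTop hneg hp
    filter_upwards [hm.eventually_lt_atBot (eval z (f i)), ht.eventually_gt_atTop 0] with k hk hk0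
    simpa [div_mul_cancel₀ _ (pow_pos hk0 (f i).totalDegree).ne'] using hk
  obtain ⟨k, hk⟩ := hev.exists
  exact hz.2 (x k) (hxK k) hk
end
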